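/- For every first-order language L there is no uniform choice function on formulas: there is no function f : Formula L ℕ → Formula L ℕ → Formula L ℕ such that (i) f φ ψ ∈ {φ, ψ} for all φ, ψ; (ii) f φ ψ = f ψ φ for all φ, ψ; and (iii) uniformity holds, i.e. for all formulas φ, ψ and every substitution σ : ℕ → Term L ℕ, if f φ ψ is semantically equivalent to φ, then f (subst φ σ) (subst ψ σ) is semantically equivalent to subst φ σ. -/

import Mathlib

open FirstOrder Language

/-- Two `L`-formulas with free variables indexed by `ℕ` are semantically equivalent if in
every (nonempty) `L`-structure, every valuation of the free variables realizes one formula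
exactly when it realizes the other. -/
def SemEquiv (L : Language) (φ ψ : L.Formula ℕ) : Prop :=
  ∀ (M : Type) [L.Structure M] [Nonempty M] (v : ℕ → M), φ.Realize v ↔ ψ.Realize v

/-- The equation between the variables `i` and `j`. -/
def varEq (L : Language) (i j : ℕ) : L.Formula ℕ :=
  Language.Term.equal (Language.Term.var i) (Language.Term.var j)

theorem varEq_subst (L : Language) (i j : ℕ) (g : ℕ → ℕ) :
    Language.BoundedFormula.subst (varEq L i j) (fun n => (Language.Term.var (g n) : L.Term ℕ))
      = varEq L (g i) (g j) := rfl

theorem varEq_not_semEquiv (L : Language) : ¬ SemEquiv L (varEq L 0 1) (varEq L 2 3) := by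
  intro h
  letI : L.Structure Bool := { funMap := fun _ _ => false, RelMap := fun _ _ => False }
  have := h Bool (fun n => decide (n = 3))
  simp [varEq, Language.Formula.realize_equal] at this

/-- **Impossibility of uniform choice functions on formulas.**  For every first-order
language `L` there is no function `f` on pairs of `L`-formulas such that
(i) `f φ ψ ∈ {φ, ψ}`, (ii) `f φ ψ = f ψ φ`, and (iii) `f` is uniform: for every
substitution `σ`, if `f φ ψ` is semantically equivalent to `φ`, then
`f (φ.subst σ) (ψ.subst σ)` is semantically equivalent to `φ.subst σ`. -/
theorem no_uniform_choice_function (L : Language) :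
    ¬ ∃ f : L.Formula ℕ → L.Formula ℕ → L.Formula ℕ,
        (∀ φ ψ : L.Formula ℕ, f φ ψ = φ ∨ f φ ψ = ψ) ∧
        (∀ φ ψ : L.Formula ℕ, f φ ψ = f ψ φ) ∧
        (∀ (φ ψ : L.Formula ℕ) (σ : ℕ → L.Term ℕ),
          SemEquiv L (f φ ψ) φ →
          SemEquiv L (f (φ.subst σ) (ψ.subst σ)) (φ.subst σ)) := by
  rintro ⟨f, h1, h2, h3⟩
  let g : ℕ → ℕ := fun n => if n < 2 then n + 2 else n - 2
  let s : ℕ → L.Term ℕ := fun n => Language.Term.var (g n)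
  have e1 : Language.BoundedFormula.subst (varEq L 0 1) s = varEq L 2 3 := varEq_subst L 0 1 g
  have e2 : Language.BoundedFormula.subst (varEq L 2 3) s = varEq L 0 1 := varEq_subst L 2 3 g
  rcases h1 (varEq L 0 1) (varEq L 2 3) with h | h
  · have k := h3 (varEq L 0 1) (varEq L 2 3) s (by rw [h]; intro M _ _ v; rfl)
    rw [e1, e2, h2, h] at k
    exact varEq_not_semEquiv L k
  · have k := h3 (varEq L 2 3) (varEq L 0 1) s (by rw [h2, h]; intro M _ _ v; rfl)
    rw [e1, e2, h] at k
    exact varEq_not_semEquiv L (fun M _ _ v => (k M v).symm)
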